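/- Let C be a Noetherian collection of subsets of a set X and let B be the Boolean algebra of subsets of X generated by C (all finite Boolean combinations of members of C). Then there is no binary tree of nonempty sets from B, i.e. no family (Y_s), indexed by finite binary sequences s, of nonempty members of B such that Y_{s⌢i} ⊆ Y_s for i = 0, 1 and Y_{s⌢0} ∩ Y_{s⌢1} = ∅ for every s. (This is the combinatorial content of the fact that Noetherian theories are totally transcendental.) -/

import Mathlib

/-- A family of subsets satisfies the descending chain condition if every
decreasing chain of members eventually stabilises. -/
def FamilyDCC {X : Type*} (C : Set (Set X)) : Prop :=
  ∀ f : ℕ → Set X, (∀ n, f n ∈ C) → (∀ n, f (n + 1) ⊆ f n) →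
    ∃ n₀, ∀ n, n₀ ≤ n → f n = f n₀

/-- A collection of subsets of `X` is Noetherian if it contains `X`, is closed
under finite (binary) intersections and satisfies the descending chain condition. -/
def NoetherianFamily {X : Type*} (C : Set (Set X)) : Prop :=
  Set.univ ∈ C ∧ (∀ A ∈ C, ∀ B ∈ C, A ∩ B ∈ C) ∧ FamilyDCC C

/-- The Boolean algebra of subsets of `X` generated by `C`: all finite Boolean
combinations of members of `C`. -/
inductive BoolGen {X : Type*} (C : Set (Set X)) : Set X → Prop
  | of_mem : ∀ A ∈ C, BoolGen C A
  | compl : ∀ A, BoolGen C A → BoolGen C Aᶜ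
  | union : ∀ A B, BoolGen C A → BoolGen C B → BoolGen C (A ∪ B)

/-- `Y` is a binary tree of members of the Boolean algebra generated by `C`, all of whose
nodes meet `S`. -/
structure IsBinaryTreeOn {X : Type*} (C : Set (Set X)) (S : Set X) (Y : List Bool → Set X) :
    Prop where
  boolGen : ∀ s, BoolGen C (Y s)
  nonempty : ∀ s, (Y s ∩ S).Nonempty
  subset : ∀ s i, Y (s ++ [i]) ⊆ Y s
  disjoint : ∀ s, Y (s ++ [false]) ∩ Y (s ++ [true]) = ∅

namespace IsBinaryTreeOn

variable {X : Type*} {C : Set (Set X)} {S T : Set X} {Y : List Bool → Set X}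

theorem subset_append (h : IsBinaryTreeOn C S Y) (t s : List Bool) : Y (t ++ s) ⊆ Y t := by
  induction s using List.reverseRecOn with
  | nil => simp
  | append_singleton s i ih =>
    rw [← List.append_assoc]
    exact (h.subset _ i).trans ih

/-- The subtree above a node `t` is a tree on every set met by all of its nodes. -/
theorem subtree (h : IsBinaryTreeOn C S Y) (t : List Bool)
    (hT : ∀ s, (Y (t ++ s) ∩ T).Nonempty) : IsBinaryTreeOn C T fun s => Y (t ++ s) where
  boolGen s := h.boolGen _
  nonempty := hT
  subset s i := by simpa only [List.append_assoc] using h.subset (t ++ s) i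
  disjoint s := by simpa only [List.append_assoc] using h.disjoint (t ++ s)

/-- The subtree above a node `t` is a tree on every set containing `Y t ∩ S`. -/
theorem subtree_of_inter_subset (h : IsBinaryTreeOn C S Y) (t : List Bool)
    (hT : Y t ∩ S ⊆ T) : IsBinaryTreeOn C T fun s => Y (t ++ s) :=
  h.subtree t fun s => by
    obtain ⟨x, hxY, hxS⟩ := h.nonempty (t ++ s)
    exact ⟨x, hxY, hT ⟨h.subset_append t s hxY, hxS⟩⟩

theorem mono (h : IsBinaryTreeOn C S Y) (hST : S ⊆ T) : IsBinaryTreeOn C T Y :=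
  h.subtree_of_inter_subset [] (Set.inter_subset_right.trans hST)

theorem exists_or_exists_of_union (h : IsBinaryTreeOn C (S ∪ T) Y) :
    (∃ Y', IsBinaryTreeOn C S Y') ∨ ∃ Y', IsBinaryTreeOn C T Y' := by
  by_cases hS : ∀ s, (Y s ∩ S).Nonempty
  · exact .inl ⟨_, h.subtree [] hS⟩
  · push Not at hS
    obtain ⟨t, ht⟩ := hS
    refine .inr ⟨_, h.subtree_of_inter_subset t ?_⟩
    rintro x ⟨hxY, hxS | hxT⟩
    · exact (Set.eq_empty_iff_forall_notMem.mp ht x ⟨hxY, hxS⟩).elim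
    · exact hxT

end IsBinaryTreeOn

theorem FamilyDCC.exists_minimal {X : Type*} {C : Set (Set X)} (hC : FamilyDCC C)
    {P : Set X → Prop} {A₀ : Set X} (hA₀ : A₀ ∈ C) (hP : P A₀) :
    ∃ A ∈ C, P A ∧ ∀ B ∈ C, B ⊂ A → ¬ P B := by
  by_contra! hcon
  choose g hgC hgss hgP using hcon
  let next : {A // A ∈ C ∧ P A} → {A // A ∈ C ∧ P A} := fun A =>
    ⟨g A.1 A.2.1 A.2.2, hgC _ _ _, hgP _ _ _⟩
  let f : ℕ → {A // A ∈ C ∧ P A} := fun n => Nat.rec ⟨A₀, hA₀, hP⟩ (fun _ => next) n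
  have hf : ∀ n, (f (n + 1)).1 ⊂ (f n).1 := fun n => hgss _ _ _
  obtain ⟨n, hn⟩ := hC (fun n => (f n).1) (fun n => (f n).2.1) fun n => (hf n).subset
  exact (hf n).ne (hn (n + 1) n.le_succ)

/-- If `A` is minimal in `C` among the sets carrying a tree, then no Boolean combination splits
`A` into two parts that both carry a tree. -/
theorem BoolGen.not_tree_inter_or_not_tree_diff {X : Type*} {C : Set (Set X)}
    (hinter : ∀ A ∈ C, ∀ B ∈ C, A ∩ B ∈ C) {A Z : Set X} (hA : A ∈ C)
    (hmin : ∀ B ∈ C, B ⊂ A → ¬ ∃ Y, IsBinaryTreeOn C B Y) (hZ : BoolGen C Z) :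
    (¬ ∃ Y, IsBinaryTreeOn C (A ∩ Z) Y) ∨ ¬ ∃ Y, IsBinaryTreeOn C (A \ Z) Y := by
  induction hZ with
  | of_mem Z hZ =>
    by_cases hAZ : A ⊆ Z
    · right
      rintro ⟨Y, hY⟩
      obtain ⟨x, -, hxA, hxZ⟩ := hY.nonempty []
      exact hxZ (hAZ hxA)
    · exact .inl (hmin _ (hinter A hA Z hZ)
        ⟨Set.inter_subset_left, fun h => hAZ (h.trans Set.inter_subset_right)⟩)
  | compl Z _ ih =>
    rw [← Set.sdiff_eq, Set.sdiff_compl]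
    exact ih.symm
  | union Z W _ _ ihZ ihW =>
    rcases ihZ with hZ | hZ
    · rcases ihW with hW | hW
      · left
        rintro ⟨Y, hY⟩
        rw [Set.inter_union_distrib_left] at hY
        exact hY.exists_or_exists_of_union.elim hZ hW
      · exact .inr fun ⟨Y, hY⟩ =>
          hW ⟨Y, hY.mono (Set.sdiff_subset_sdiff_right Set.subset_union_right)⟩
    · exact .inr fun ⟨Y, hY⟩ =>
        hZ ⟨Y, hY.mono (Set.sdiff_subset_sdiff_right Set.subset_union_left)⟩

/-- If `C` is a Noetherian collection of subsets of `X`, then there is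
no binary tree of nonempty members of the Boolean algebra generated by `C`: no family
`Y_s`, indexed by finite binary sequences `s`, of nonempty Boolean combinations of
members of `C` such that `Y_{s⌢i} ⊆ Y_s` and `Y_{s⌢0} ∩ Y_{s⌢1} = ∅`. -/
theorem no_binary_tree {X : Type*} (C : Set (Set X)) (hC : NoetherianFamily C)
    (Y : List Bool → Set X)
    (hB : ∀ s, BoolGen C (Y s))
    (hne : ∀ s, (Y s).Nonempty)
    (hsub : ∀ s i, Y (s ++ [i]) ⊆ Y s)
    (hdisj : ∀ s, Y (s ++ [false]) ∩ Y (s ++ [true]) = ∅) :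
    False := by
  obtain ⟨huniv, hinter, hdcc⟩ := hC
  have hY : IsBinaryTreeOn C Set.univ Y := ⟨hB, by simpa using hne, hsub, hdisj⟩
  obtain ⟨A, hA, ⟨T, hT⟩, hmin⟩ :=
    hdcc.exists_minimal (P := fun S => ∃ Y, IsBinaryTreeOn C S Y) huniv ⟨Y, hY⟩
  rcases (hT.boolGen [false]).not_tree_inter_or_not_tree_diff hinter hA hmin with h | h
  · exact h ⟨_, hT.subtree_of_inter_subset [false] fun x hx => ⟨hx.2, hx.1⟩⟩
  · refine h ⟨_, hT.subtree_of_inter_subset [true] fun x hx => ⟨hx.2, fun hx' => ?_⟩⟩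
    exact Set.eq_empty_iff_forall_notMem.mp (hT.disjoint []) x ⟨hx', hx.1⟩
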